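/- Let (X_t : t ∈ ℝ) be a zero-mean stationary Gaussian process with covariance kernel R(t) = ∫ e^{itx} μ(dx), where μ is a finite non-null symmetric measure on ℝ with μ([x,∞)) > 0 for all x > 0 and μ([x,∞)) regularly varying with index −α, 0 < α < 2. Let Z_t = X_t − (R(t)/R(0)) X_0, δ_u = (h(u^{−2}))^{−1}, and β = 8/α. Then for every M > 0 there exist finite positive constants K and u_0 such that E[|u Z_{sδ_u} − u Z_{tδ_u}|^β] ≤ K (t − s)² for all u ≥ u_0 and all −M ≤ s < t ≤ M. -/

import Mathlib

open MeasureTheory ProbabilityTheory Filter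

/-- A real-valued stochastic process is a (zero-mean) Gaussian process if every finite
linear combination of its values has a centered Gaussian distribution. -/
def IsZeroMeanGaussianProcess {Ω : Type*} [MeasurableSpace Ω] (P : Measure Ω)
    (X : ℝ → Ω → ℝ) : Prop :=
  (∀ t, Measurable (X t)) ∧
  ∀ (n : ℕ) (t : Fin n → ℝ) (c : Fin n → ℝ),
    ∃ v : NNReal, P.map (fun ω => ∑ i, c i * X (t i) ω) = gaussianReal 0 v

/-- A property that holds on `[a, 2a]` and is preserved by doubling holds on `[a, ∞)`. -/
theorem forall_ge_of_doubling {p : ℝ → Prop} {a : ℝ} (ha : 0 < a)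
    (base : ∀ b, a ≤ b → b ≤ 2 * a → p b) (step : ∀ b, a ≤ b → p b → p (2 * b)) :
    ∀ b, a ≤ b → p b := by
  have key : ∀ n : ℕ, ∀ b, a ≤ b → b ≤ 2 ^ n * a → p b := by
    intro n
    induction n with
    | zero => intro b h1 h2; exact base b h1 (by simp at h2; linarith)
    | succ n ih =>
      intro b h1 h2
      by_cases hb : b ≤ 2 * a
      · exact base b h1 hb
      · have := step (b / 2) (by linarith)
          (ih (b / 2) (by linarith) (by rw [pow_succ] at h2; linarith))
        rwa [mul_div_cancel₀ b (two_ne_zero)] at this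
  intro b hb
  obtain ⟨n, hn⟩ := pow_unbounded_of_one_lt (b / a) (one_lt_two)
  exact key n b hb ((div_le_iff₀ ha).1 hn.le)

theorem tendsto_measure_Ici_toReal_atTop (μ : Measure ℝ) [IsFiniteMeasure μ] :
    Tendsto (fun x : ℝ => (μ (Set.Ici x)).toReal) atTop (nhds 0) := by
  have h := tendsto_measure_iInter_atTop (μ := μ) (s := fun x : ℝ => Set.Ici x)
    (fun i => measurableSet_Ici.nullMeasurableSet) (fun a b hab => Set.Ici_subset_Ici.2 hab)
    ⟨0, measure_ne_top _ _⟩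
  have he : (⋂ x : ℝ, Set.Ici x) = ∅ := by
    ext y
    simp only [Set.mem_iInter, Set.mem_Ici, Set.mem_empty_iff_false, iff_false, not_forall, not_le]
    exact exists_gt y
  rw [he, measure_empty] at h
  exact (ENNReal.tendsto_toReal ENNReal.zero_ne_top).comp h

/-- Regular variation along doubling gives two-sided doubling bounds with perturbed exponents. -/
theorem exists_doubling_bounds {T : ℝ → ℝ} {α p q : ℝ} (hT : ∀ x > (0 : ℝ), 0 < T x)
    (hrv : Tendsto (fun x => T (2 * x) / T x) atTop (nhds ((2 : ℝ) ^ (-α))))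
    (hp : p < α) (hq : α < q) :
    ∃ a > (0 : ℝ), ∀ x ≥ a, (2 : ℝ) ^ (-q) * T x ≤ T (2 * x) ∧ T (2 * x) ≤ (2 : ℝ) ^ (-p) * T x := by
  have h1 := hrv.eventually_le_const
    (show (2 : ℝ) ^ (-α) < (2 : ℝ) ^ (-p) from Real.rpow_lt_rpow_of_exponent_lt one_lt_two (by linarith))
  have h2 := hrv.eventually_const_le
    (show (2 : ℝ) ^ (-q) < (2 : ℝ) ^ (-α) from Real.rpow_lt_rpow_of_exponent_lt one_lt_two (by linarith))
  obtain ⟨a, ha⟩ := eventually_atTop.1 (h1.and h2)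
  refine ⟨max a 1, by positivity, fun x hx => ?_⟩
  have hx1 : 0 < x := lt_of_lt_of_le one_pos ((le_max_right a 1).trans hx)
  obtain ⟨h3, h4⟩ := ha x ((le_max_left a 1).trans hx)
  exact ⟨(le_div_iff₀ (hT x hx1)).1 h4, (div_le_iff₀ (hT x hx1)).1 h3⟩

theorem rpow_decay_of_doubling {T : ℝ → ℝ} {p a : ℝ} (hT : Antitone T) (hp : 0 ≤ p)
    (hT0 : ∀ x, 0 ≤ T x) (ha : 0 < a) (hd : ∀ x ≥ a, T (2 * x) ≤ (2 : ℝ) ^ (-p) * T x) :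
    ∀ b, a ≤ b → T b * b ^ p ≤ T a * (2 * a) ^ p := by
  refine forall_ge_of_doubling (p := fun b => T b * b ^ p ≤ T a * (2 * a) ^ p) ha ?_ ?_
  · intro b h1 h2
    have hb : 0 < b := ha.trans_le h1
    exact mul_le_mul (hT h1) (Real.rpow_le_rpow hb.le h2 hp) (by positivity) (hT0 a)
  · intro b h1 ih
    have hb : 0 < b := ha.trans_le h1
    have h2 : (2 : ℝ) ^ (-p) * (2 : ℝ) ^ p = 1 := by
      rw [← Real.rpow_add two_pos]; simp
    calc T (2 * b) * (2 * b) ^ p ≤ ((2 : ℝ) ^ (-p) * T b) * (2 * b) ^ p := by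
          gcongr; exact hd b h1
      _ = ((2 : ℝ) ^ (-p) * (2 : ℝ) ^ p) * (T b * b ^ p) := by
          rw [Real.mul_rpow two_pos.le hb.le]; ring
      _ ≤ _ := by rw [h2, one_mul]; exact ih

theorem integrable_min_one_sq_div (μ : Measure ℝ) [IsFiniteMeasure μ] (a : ℝ) :
    Integrable (fun x : ℝ => min 1 (x ^ 2 / a ^ 2)) μ := by
  refine Integrable.of_bound (by fun_prop) 1 (ae_of_all _ fun x => ?_)
  rw [Real.norm_of_nonneg (by positivity)]
  exact min_le_left _ _

theorem integral_min_one_sq_div_two_mul_le (μ : Measure ℝ) [IsFiniteMeasure μ]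
    (hμ : μ.map (fun x => -x) = μ) {a : ℝ} (ha : 0 < a) :
    ∫ x, min 1 (x ^ 2 / (2 * a) ^ 2) ∂μ
      ≤ (∫ x, min 1 (x ^ 2 / a ^ 2) ∂μ) / 4 + 2 * (μ (Set.Ici a)).toReal := by
  have hI : ∀ s : Set ℝ, MeasurableSet s → Integrable (s.indicator (fun _ => (1 : ℝ))) μ :=
    fun s hs => (integrable_const 1).indicator hs
  have hneg : (μ (Set.Iic (-a))).toReal = (μ (Set.Ici a)).toReal := by
    conv_rhs => rw [← hμ, Measure.map_apply measurable_neg measurableSet_Ici]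
    congr 2
    ext x
    simp
  have hW := integrable_min_one_sq_div μ a
  calc ∫ x, min 1 (x ^ 2 / (2 * a) ^ 2) ∂μ
      ≤ ∫ x, (min 1 (x ^ 2 / a ^ 2) / 4 + ((Set.Ici a).indicator (fun _ => (1 : ℝ)) x
          + (Set.Iic (-a)).indicator (fun _ => (1 : ℝ)) x)) ∂μ := by
        refine integral_mono (integrable_min_one_sq_div μ _)
          ((hW.div_const 4).add ((hI _ measurableSet_Ici).add (hI _ measurableSet_Iic)))
          fun x => ?_
        have h0 : 0 ≤ min 1 (x ^ 2 / a ^ 2) := by positivity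
        have h1 : 0 ≤ (Set.Ici a).indicator (fun _ => (1 : ℝ)) x :=
          Set.indicator_nonneg (fun _ _ => zero_le_one) x
        have h2 : 0 ≤ (Set.Iic (-a)).indicator (fun _ => (1 : ℝ)) x :=
          Set.indicator_nonneg (fun _ _ => zero_le_one) x
        have h3 : min 1 (x ^ 2 / (2 * a) ^ 2) ≤ 1 := min_le_left _ _
        show min 1 (x ^ 2 / (2 * a) ^ 2) ≤ _
        by_cases hx : a ≤ x
        · have : (Set.Ici a).indicator (fun _ => (1 : ℝ)) x = 1 :=
            Set.indicator_of_mem (Set.mem_Ici.2 hx) _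
          linarith
        by_cases hx' : x ≤ -a
        · have : (Set.Iic (-a)).indicator (fun _ => (1 : ℝ)) x = 1 :=
            Set.indicator_of_mem (Set.mem_Iic.2 hx') _
          linarith
        have h4 : x ^ 2 / a ^ 2 ≤ 1 := by
          rw [div_le_one (by positivity)]
          push Not at hx hx'
          nlinarith
        have h5 : x ^ 2 / (2 * a) ^ 2 = x ^ 2 / a ^ 2 / 4 := by field_simp; norm_num
        have := min_le_right 1 (x ^ 2 / (2 * a) ^ 2)
        rw [min_eq_right h4]
        linarith
    _ = _ := by
        have hd : Integrable (fun x => min 1 (x ^ 2 / a ^ 2) / 4) μ := hW.div_const 4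
        have hs : Integrable (fun x => (Set.Ici a).indicator (fun _ => (1 : ℝ)) x
            + (Set.Iic (-a)).indicator (fun _ => (1 : ℝ)) x) μ :=
          (hI _ measurableSet_Ici).add (hI _ measurableSet_Iic)
        rw [integral_add hd hs, integral_add (hI _ measurableSet_Ici) (hI _ measurableSet_Iic), integral_div,
          integral_indicator_const _ measurableSet_Ici, integral_indicator_const _ measurableSet_Iic]
        simp only [Measure.real, smul_eq_mul, mul_one]
        rw [hneg]
        ring

/-- A Karamata-type bound: the truncated second moment is dominated by the tail. -/
theorem exists_integral_min_one_sq_div_le (μ : Measure ℝ) [IsFiniteMeasure μ]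
    (hμ : μ.map (fun x => -x) = μ) {q a : ℝ} (hq : q < 2) (ha : 0 < a)
    (hpos : ∀ x > (0 : ℝ), 0 < μ (Set.Ici x))
    (hd : ∀ x ≥ a, (2 : ℝ) ^ (-q) * (μ (Set.Ici x)).toReal ≤ (μ (Set.Ici (2 * x))).toReal) :
    ∃ B > (0 : ℝ), ∀ b, a ≤ b →
      ∫ x, min 1 (x ^ 2 / b ^ 2) ∂μ ≤ B * (μ (Set.Ici b)).toReal := by
  have hT : ∀ x > (0 : ℝ), 0 < (μ (Set.Ici x)).toReal := fun x hx =>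
    ENNReal.toReal_pos (hpos x hx).ne' (measure_ne_top _ _)
  set r : ℝ := (2 : ℝ) ^ (-q) with hr
  have hr4 : 1 / 4 < r := by
    have : (2 : ℝ) ^ (-2 : ℝ) < (2 : ℝ) ^ (-q) :=
      Real.rpow_lt_rpow_of_exponent_lt one_lt_two (by linarith)
    rw [Real.rpow_neg two_pos.le, Real.rpow_two] at this
    norm_num at this ⊢
    exact this
  set m := (μ Set.univ).toReal
  have hW1 : ∀ b, ∫ x, min 1 (x ^ 2 / b ^ 2) ∂μ ≤ m := fun b => by
    calc _ ≤ ∫ _, (1 : ℝ) ∂μ := integral_mono (integrable_min_one_sq_div μ b)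
            (integrable_const 1) fun x => min_le_left _ _
      _ = m := by simp [m, Measure.real]
  have hm : 0 ≤ m := ENNReal.toReal_nonneg
  have hT2 := hT (2 * a) (by positivity)
  set B := max (m / (μ (Set.Ici (2 * a))).toReal) (2 / (r - 1 / 4)) with hB
  have hBpos : 0 < B := lt_max_of_lt_right (div_pos two_pos (by linarith))
  refine ⟨B, hBpos, forall_ge_of_doubling ha ?_ ?_⟩
  · intro b h1 h2
    refine (hW1 b).trans ?_
    calc m = m / (μ (Set.Ici (2 * a))).toReal * (μ (Set.Ici (2 * a))).toReal := by
          field_simp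
      _ ≤ B * (μ (Set.Ici b)).toReal := by
          gcongr
          · exact le_max_left _ _
          · exact measure_ne_top _ _
  · intro b h1 ih
    have hb : 0 < b := ha.trans_le h1
    have h3 := integral_min_one_sq_div_two_mul_le μ hμ hb
    have h4 := hd b h1
    have h5 : 2 ≤ B * (r - 1 / 4) := by
      rw [← div_le_iff₀ (by linarith)]; exact le_max_right _ _
    have h6 := mul_le_mul_of_nonneg_right h5 (hT b hb).le
    have h7 := mul_le_mul_of_nonneg_left h4 hBpos.le
    linarith

theorem integral_one_sub_cos_le (μ : Measure ℝ) [IsFiniteMeasure μ] {H t : ℝ} :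
    ∫ x, (1 - Real.cos (t / H * x)) ∂μ ≤ 2 * ∫ x, min 1 (x ^ 2 / (H / t) ^ 2) ∂μ := by
  rw [← integral_const_mul]
  refine integral_mono ?_ ((integrable_min_one_sq_div μ _).const_mul 2) fun x => ?_
  · refine Integrable.of_bound (by fun_prop) 2 (ae_of_all _ fun x => ?_)
    rw [Real.norm_eq_abs, abs_le]
    constructor <;> linarith [Real.cos_le_one (t / H * x), Real.neg_one_le_cos (t / H * x)]
  · have h1 := Real.one_sub_sq_div_two_le_cos (x := t / H * x)
    have h2 := Real.neg_one_le_cos (t / H * x)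
    have h3 : x ^ 2 / (H / t) ^ 2 = (t / H * x) ^ 2 := by
      rw [div_pow, div_div_eq_mul_div]; ring
    show 1 - Real.cos (t / H * x) ≤ 2 * min 1 (x ^ 2 / (H / t) ^ 2)
    rw [h3, mul_min_of_nonneg _ _ two_pos.le]
    refine le_min (by linarith) (by nlinarith [sq_nonneg (t / H * x)])

theorem integral_abs_rpow_gaussianReal (v : NNReal) (p : ℝ) :
    ∫ x, |x| ^ p ∂gaussianReal 0 v
      = (∫ x, |x| ^ p ∂gaussianReal 0 1) * (v : ℝ) ^ (p / 2) := by
  have h : gaussianReal 0 v = (gaussianReal 0 1).map (Real.sqrt v * ·) := by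
    rw [gaussianReal_map_const_mul]
    congr 1
    · simp
    · ext; simp
  conv_lhs => rw [h]
  rw [integral_map (by fun_prop) (by
    exact (measurable_id.abs.pow_const p).aestronglyMeasurable), mul_comm, ← integral_const_mul]
  congr 1 with x
  rw [abs_mul, abs_of_nonneg (Real.sqrt_nonneg _),
    Real.mul_rpow (Real.sqrt_nonneg _) (abs_nonneg _), Real.sqrt_eq_rpow,
    ← Real.rpow_mul v.coe_nonneg]
  congr 2
  ring

section Gaussian

variable {Ω : Type*} [MeasurableSpace Ω] {P : Measure Ω} {X : ℝ → Ω → ℝ}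

theorem IsZeroMeanGaussianProcess.memLp_two (hX : IsZeroMeanGaussianProcess P X) (t : ℝ) :
    MemLp (X t) 2 P := by
  obtain ⟨v, hv⟩ := hX.2 1 (fun _ => t) (fun _ => 1)
  simp only [Finset.univ_unique, one_mul, Finset.sum_const, Finset.card_singleton, one_smul] at hv
  have h := memLp_id_gaussianReal' (μ := 0) (v := v) 2 (by simp)
  rw [← hv] at h
  exact (memLp_map_measure_iff (by fun_prop) (hX.1 t).aemeasurable).1 h

/-- The absolute moments of a linear combination of three values of a Gaussian process. -/
theorem IsZeroMeanGaussianProcess.integral_abs_rpow (hX : IsZeroMeanGaussianProcess P X)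
    (r s t a b c p : ℝ) :
    ∫ ω, |a * X r ω + b * X s ω + c * X t ω| ^ p ∂P
      = (∫ x, |x| ^ p ∂gaussianReal 0 1)
        * (∫ ω, (a * X r ω + b * X s ω + c * X t ω) ^ 2 ∂P) ^ (p / 2) := by
  obtain ⟨v, hv⟩ := hX.2 3 ![r, s, t] ![a, b, c]
  simp only [Fin.sum_univ_three, Matrix.cons_val_zero, Matrix.cons_val_one, Matrix.cons_val] at hv
  have hm : Measurable (fun ω => a * X r ω + b * X s ω + c * X t ω) :=
    (((hX.1 r).const_mul a).add ((hX.1 s).const_mul b)).add ((hX.1 t).const_mul c)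
  have h1 : ∫ ω, (a * X r ω + b * X s ω + c * X t ω) ^ 2 ∂P = v := by
    have := integral_map (μ := P) hm.aemeasurable (f := fun x : ℝ => x ^ 2) (by fun_prop)
    rw [← this, hv, ← variance_id_gaussianReal (μ := 0) (v := v),
      variance_of_integral_eq_zero (by fun_prop) (by simp)]
    rfl
  rw [h1, ← integral_abs_rpow_gaussianReal, ← hv]
  exact (integral_map hm.aemeasurable
    (measurable_id.abs.pow_const p).aestronglyMeasurable).symm

theorem IsZeroMeanGaussianProcess.integral_sq (hX : IsZeroMeanGaussianProcess P X)
    {R : ℝ → ℝ} (hcov : ∀ s t : ℝ, ∫ ω, X s ω * X t ω ∂P = R (s - t)) (r s t a b c : ℝ) :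
    ∫ ω, (a * X r ω + b * X s ω + c * X t ω) ^ 2 ∂P
      = (a ^ 2 + b ^ 2 + c ^ 2) * R 0 + 2 * a * b * R (r - s) + 2 * a * c * R (r - t)
        + 2 * b * c * R (s - t) := by
  have hi : ∀ x y, Integrable (fun ω => X x ω * X y ω) P := fun x y =>
    (hX.memLp_two x).integrable_mul (hX.memLp_two y)
  have he : ∀ ω, (a * X r ω + b * X s ω + c * X t ω) ^ 2
      = a ^ 2 * (X r ω * X r ω) + b ^ 2 * (X s ω * X s ω) + c ^ 2 * (X t ω * X t ω)
        + 2 * a * b * (X r ω * X s ω) + 2 * a * c * (X r ω * X t ω)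
        + 2 * b * c * (X s ω * X t ω) := fun ω => by ring
  simp_rw [he]
  have hi' : ∀ k x y, Integrable (fun ω => k * (X x ω * X y ω)) P := fun k x y =>
    (hi x y).const_mul k
  rw [integral_add, integral_add, integral_add, integral_add, integral_add]
  · simp only [integral_const_mul, hcov, sub_self]
    ring
  all_goals fun_prop (disch := apply hi')

end Gaussian

/-- Properties of the generalized inverse of the tail, along levels tending to zero. -/
theorem tail_inverse_properties (μ : Measure ℝ) [IsFiniteMeasure μ]
    (hpos : ∀ x > (0 : ℝ), 0 < μ (Set.Ici x)) {h : ℝ → ℝ}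
    (hh : ∀ y : ℝ, h y = sInf {x : ℝ | 0 ≤ x ∧ (μ (Set.Ici x)).toReal ≤ y}) :
    (∀ A > 0, ∃ ε > 0, ∀ y, 0 < y → y < ε → A ≤ h y) ∧
      ∀ y > 0, 0 < h y → (μ (Set.Ici (2 * h y))).toReal ≤ y := by
  have hne : ∀ y > 0, {x : ℝ | 0 ≤ x ∧ (μ (Set.Ici x)).toReal ≤ y}.Nonempty := fun y hy => by
    obtain ⟨x, h1, h2⟩ := ((eventually_ge_atTop 0).and
      ((tendsto_measure_Ici_toReal_atTop μ).eventually_le_const hy)).exists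
    exact ⟨x, h1, h2⟩
  have hanti : ∀ {x y : ℝ}, x ≤ y → (μ (Set.Ici y)).toReal ≤ (μ (Set.Ici x)).toReal :=
    fun hxy => ENNReal.toReal_mono (measure_ne_top _ _) (measure_mono (Set.Ici_subset_Ici.2 hxy))
  refine ⟨fun A hA => ⟨(μ (Set.Ici A)).toReal,
    ENNReal.toReal_pos (hpos A hA).ne' (measure_ne_top _ _), fun y hy0 hy => ?_⟩,
    fun y hy hhy => ?_⟩
  · rw [hh]
    refine le_csInf (hne y hy0) fun x hx => ?_
    by_contra! hxA
    linarith [hanti hxA.le, hx.2]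
  · obtain ⟨x, hx, hxh⟩ := exists_lt_of_csInf_lt (hne y hy)
      (show sInf {x : ℝ | 0 ≤ x ∧ (μ (Set.Ici x)).toReal ≤ y} < 2 * h y by rw [← hh]; linarith)
    exact (hanti hxh.le).trans hx.2

/-- Truncated second moments at the scale of the inverse tail. -/
theorem exists_integral_min_one_sq_div_inverse_le {α : ℝ} (hα0 : 0 < α) (hα2 : α < 2)
    (μ : Measure ℝ) [IsFiniteMeasure μ] (hsymm : μ.map (fun x => -x) = μ)
    (hpos : ∀ x > (0 : ℝ), 0 < μ (Set.Ici x))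
    (hrv : Tendsto (fun x : ℝ => (μ (Set.Ici (2 * x))).toReal / (μ (Set.Ici x)).toReal)
      atTop (nhds ((2 : ℝ) ^ (-α))))
    {h : ℝ → ℝ} (hh : ∀ y : ℝ, h y = sInf {x : ℝ | 0 ≤ x ∧ (μ (Set.Ici x)).toReal ≤ y})
    (L : ℝ) :
    ∃ C > (0 : ℝ), ∃ ε > (0 : ℝ), ∀ y, 0 < y → y < ε → 0 < h y ∧ ∀ τ, 0 < τ → τ ≤ L →
      ∫ x, min 1 (x ^ 2 / (h y / τ) ^ 2) ∂μ ≤ C * τ ^ (α / 2) * y := by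
  have hT : ∀ x > (0 : ℝ), 0 < (μ (Set.Ici x)).toReal := fun x hx =>
    ENNReal.toReal_pos (hpos x hx).ne' (measure_ne_top _ _)
  have hanti : Antitone fun x : ℝ => (μ (Set.Ici x)).toReal := fun x y hxy =>
    ENNReal.toReal_mono (measure_ne_top _ _) (measure_mono (Set.Ici_subset_Ici.2 hxy))
  obtain ⟨a, ha, hd⟩ := exists_doubling_bounds (p := α / 2) (q := (α + 2) / 2) hT hrv
    (by linarith) (by linarith)
  obtain ⟨B, hB, hW⟩ := exists_integral_min_one_sq_div_le μ hsymm (q := (α + 2) / 2) (by linarith)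
    ha hpos fun x hx => (hd x hx).1
  obtain ⟨hinf, hlev⟩ := tail_inverse_properties μ hpos hh
  set r : ℝ := (2 : ℝ) ^ (-((α + 2) / 2)) with hr
  have hr0 : 0 < r := by positivity
  have hiter : ∀ n : ℕ, ∀ x ≥ a, r ^ n * (μ (Set.Ici x)).toReal ≤ (μ (Set.Ici (2 ^ n * x))).toReal := by
    intro n
    induction n with
    | zero => intro x _; simp
    | succ n ih =>
      intro x hx
      have h1 := (hd x hx).1
      have h2 := ih (2 * x) (by linarith)
      rw [← mul_assoc, ← pow_succ] at h2
      refine le_trans ?_ h2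
      rw [pow_succ, mul_assoc]
      gcongr
  obtain ⟨k, hk⟩ := pow_unbounded_of_one_lt L (one_lt_two (α := ℝ))
  have hN : (0 : ℝ) < 2 ^ k := by positivity
  obtain ⟨ε, hε, hHε⟩ := hinf (2 ^ k * a) (by positivity)
  refine ⟨B * (r ^ (k + 1))⁻¹ * (2 / 2 ^ k) ^ (α / 2), by positivity, ε, hε, fun y hy0 hy => ?_⟩
  have hH := hHε y hy0 hy
  have hH0 : 0 < h y := lt_of_lt_of_le (by positivity) hH
  refine ⟨hH0, fun τ hτ hτL => ?_⟩
  have haN : a ≤ h y / 2 ^ k := by rw [le_div_iff₀ hN]; linarith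
  have hNτ : h y / 2 ^ k ≤ h y / τ := by gcongr; linarith
  have h1 := hW (h y / τ) (haN.trans hNτ)
  have h2 := rpow_decay_of_doubling hanti (p := α / 2) (by linarith)
    (fun x => ENNReal.toReal_nonneg) (ha.trans_le haN)
    (fun x hx => (hd x (haN.trans hx)).2) (h y / τ) hNτ
  have h3 := hiter (k + 1) _ haN
  have h4 : (2 : ℝ) ^ (k + 1) * (h y / 2 ^ k) = 2 * h y := by field_simp; ring
  rw [h4] at h3
  have h5 : (μ (Set.Ici (h y / 2 ^ k))).toReal ≤ (r ^ (k + 1))⁻¹ * y := by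
    rw [inv_mul_eq_div, le_div_iff₀ (by positivity), mul_comm]
    exact h3.trans (hlev y hy0 hH0)
  have h6 : (μ (Set.Ici (h y / τ))).toReal
      ≤ (μ (Set.Ici (h y / 2 ^ k))).toReal * ((2 / 2 ^ k) ^ (α / 2) * τ ^ (α / 2)) := by
    have hb : 0 < (h y / τ) ^ (α / 2) := by positivity
    rw [← mul_le_mul_iff_left₀ hb]
    refine h2.trans_eq ?_
    rw [mul_assoc, ← Real.mul_rpow (by positivity) hτ.le,
      ← Real.mul_rpow (by positivity) (by positivity)]
    congr 2
    field_simp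
  calc _ ≤ B * (μ (Set.Ici (h y / τ))).toReal := h1
    _ ≤ B * ((r ^ (k + 1))⁻¹ * y * ((2 / 2 ^ k) ^ (α / 2) * τ ^ (α / 2))) := by
        gcongr
        exact h6.trans (by gcongr)
    _ = _ := by ring

theorem integral_cexp_eq_integral_cos {μ : Measure ℝ} [IsFiniteMeasure μ] {R : ℝ → ℝ}
    (hR : ∀ t : ℝ, (R t : ℂ) = ∫ x : ℝ, Complex.exp (Complex.I * t * x) ∂μ) (t : ℝ) :
    R t = ∫ x, Real.cos (t * x) ∂μ := by
  have hint : Integrable (fun x : ℝ => Complex.exp (Complex.I * t * x)) μ := by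
    refine Integrable.of_bound (by fun_prop) 1 (ae_of_all _ fun x => ?_)
    rw [mul_assoc, mul_comm, ← Complex.ofReal_mul, Complex.norm_exp_ofReal_mul_I]
  have h := congrArg Complex.re (hR t)
  rw [Complex.ofReal_re] at h
  rw [h, ← RCLike.re_eq_complex_re, ← integral_re hint]
  congr 1 with x
  rw [mul_assoc, mul_comm, ← Complex.ofReal_mul]
  exact Complex.exp_ofReal_mul_I_re _

/-- with `Z_t = X_t - (R(t)/R(0)) X₀`, `δ_u = (h(u⁻²))⁻¹` and `β = 8/α`:
for every `M > 0` there exist finite positive constants `K` and `u₀` such that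
`E |u Z_{sδ_u} - u Z_{tδ_u}|^β ≤ K (t-s)²` for all `u ≥ u₀` and `-M ≤ s < t ≤ M`. -/
theorem excursion_stmt12
    (α : ℝ) (hα0 : 0 < α) (hα2 : α < 2)
    (μ : Measure ℝ) [IsFiniteMeasure μ]
    (hμ_nonnull : μ Set.univ ≠ 0)
    (hμ_symm : μ.map (fun x => -x) = μ)
    (hμ_tail_pos : ∀ x > (0 : ℝ), 0 < μ (Set.Ici x))
    (hμ_rv : ∀ c > (0 : ℝ),
      Tendsto (fun x : ℝ => (μ (Set.Ici (c * x))).toReal / (μ (Set.Ici x)).toReal)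
        atTop (nhds (c ^ (-α))))
    (R : ℝ → ℝ)
    (hR : ∀ t : ℝ, (R t : ℂ) = ∫ x : ℝ, Complex.exp (Complex.I * t * x) ∂μ)
    {Ω : Type*} [MeasurableSpace Ω] (P : Measure Ω) [IsProbabilityMeasure P]
    (X : ℝ → Ω → ℝ)
    (hX_gauss : IsZeroMeanGaussianProcess P X)
    (hX_cov : ∀ s t : ℝ, ∫ ω, X s ω * X t ω ∂P = R (s - t))
    (Z : ℝ → Ω → ℝ)
    (hZ : ∀ t ω, Z t ω = X t ω - R t / R 0 * X 0 ω)
    (h : ℝ → ℝ)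
    (hh : ∀ y : ℝ, h y = sInf {x : ℝ | 0 ≤ x ∧ (μ (Set.Ici x)).toReal ≤ y})
    (δ : ℝ → ℝ)
    (hδ : ∀ u : ℝ, δ u = (h (u ^ (-2 : ℝ)))⁻¹) :
    ∀ M > (0 : ℝ), ∃ K > (0 : ℝ), ∃ u₀ > (0 : ℝ),
      ∀ u ≥ u₀, ∀ s t : ℝ, -M ≤ s → s < t → t ≤ M →
        ∫ ω, |u * Z (s * δ u) ω - u * Z (t * δ u) ω| ^ (8 / α) ∂P ≤ K * (t - s) ^ 2 := by
  intro M _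
  have hcos := integral_cexp_eq_integral_cos hR
  have hR0 : 0 < R 0 := by
    rw [hcos]
    simpa [Measure.real] using ENNReal.toReal_pos hμ_nonnull (measure_ne_top _ _)
  obtain ⟨C, hC, ε, hε, hbound⟩ := exists_integral_min_one_sq_div_inverse_le hα0 hα2 μ hμ_symm
    hμ_tail_pos (hμ_rv 2 two_pos) hh (2 * M)
  set m := ∫ x, |x| ^ (8 / α) ∂gaussianReal 0 1
  have hm : 0 ≤ m := integral_nonneg fun x => by positivity
  obtain ⟨u₁, hu₁⟩ := eventually_atTop.1
    ((tendsto_rpow_neg_atTop (two_pos : (0 : ℝ) < 2)).eventually_lt_const hε)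
  refine ⟨m * (4 * C) ^ (8 / α / 2) + 1, by positivity, max u₁ 1, by positivity,
    fun u hu s t hs hst ht => ?_⟩
  have hu0 : 0 < u := lt_of_lt_of_le one_pos ((le_max_right _ _).trans hu)
  obtain ⟨hH, hW⟩ := hbound (u ^ (-2 : ℝ)) (by positivity) (hu₁ u ((le_max_left _ _).trans hu))
  have hτ : 0 < t - s := sub_pos.2 hst
  have hW := hW (t - s) hτ (by linarith)
  set H := h (u ^ (-2 : ℝ))
  set d := u * ((R (t * δ u) - R (s * δ u)) / R 0) with hd
  have hZ' : ∀ ω, u * Z (s * δ u) ω - u * Z (t * δ u) ω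
      = u * X (s * δ u) ω + (-u) * X (t * δ u) ω + d * X 0 ω := fun ω => by
    rw [hZ, hZ, hd]; ring
  simp_rw [hZ']
  rw [hX_gauss.integral_abs_rpow, hX_gauss.integral_sq hX_cov, sub_zero, sub_zero]
  have hinc : R 0 - R (s * δ u - t * δ u) = ∫ x, (1 - Real.cos ((t - s) / H * x)) ∂μ := by
    rw [integral_sub (integrable_const 1) (Integrable.of_bound (by fun_prop) 1
      (ae_of_all _ fun x => Real.abs_cos_le_one _)), hcos, hcos, hδ]
    congr 1
    · simp
    · congr 1 with x
      rw [← Real.cos_neg]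
      congr 1
      ring
  have hle := (hinc.trans_le (integral_one_sub_cos_le μ)).trans
    (mul_le_mul_of_nonneg_left hW two_pos.le)
  have hu2 : u ^ 2 * u ^ (-2 : ℝ) = 1 := by
    rw [Real.rpow_neg hu0.le, Real.rpow_two]; field_simp
  have hvar : (u ^ 2 + (-u) ^ 2 + d ^ 2) * R 0 + 2 * u * -u * R (s * δ u - t * δ u)
      + 2 * u * d * R (s * δ u) + 2 * -u * d * R (t * δ u)
      ≤ 4 * C * (t - s) ^ (α / 2) := by
    have h1 : u * (R (t * δ u) - R (s * δ u)) = d * R 0 := by rw [hd]; field_simp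
    have h2 : 0 ≤ d ^ 2 * R 0 := by positivity
    have h3 := mul_le_mul_of_nonneg_left hle (sq_nonneg u)
    calc _ = 2 * (u ^ 2 * (R 0 - R (s * δ u - t * δ u))) + d ^ 2 * R 0
          - 2 * d * (u * (R (t * δ u) - R (s * δ u))) := by ring
      _ = 2 * (u ^ 2 * (R 0 - R (s * δ u - t * δ u))) - d ^ 2 * R 0 := by rw [h1]; ring
      _ ≤ 2 * (u ^ 2 * (2 * (C * (t - s) ^ (α / 2) * u ^ (-2 : ℝ)))) := by linarith
      _ = 4 * C * (t - s) ^ (α / 2) * (u ^ 2 * u ^ (-2 : ℝ)) := by ring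
      _ = _ := by rw [hu2, mul_one]
  have hvar0 := integral_nonneg (μ := P)
    (f := fun ω => (u * X (s * δ u) ω + -u * X (t * δ u) ω + d * X 0 ω) ^ 2)
    fun ω => sq_nonneg _
  rw [hX_gauss.integral_sq hX_cov, sub_zero, sub_zero] at hvar0
  calc _ ≤ m * (4 * C * (t - s) ^ (α / 2)) ^ (8 / α / 2) := by gcongr
    _ = m * (4 * C) ^ (8 / α / 2) * (t - s) ^ 2 := by
        rw [Real.mul_rpow (by positivity) (by positivity), ← Real.rpow_mul hτ.le, mul_assoc,
          ← Real.rpow_two]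
        congr 3
        field_simp
        norm_num
    _ ≤ _ := by gcongr; linarith
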